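/- Let (A,B) be a random vector with nonnegative coordinates satisfying P(A=1)<1, P(B=0)<1, E A^κ = 1 and E B^κ < ∞ for some κ>0, and let U be the unique-in-law solution of U =_d A U + B with U independent of (A,B). Then for every ε ∈ (0, κ), one has the identity (1 − E[A^{κ−ε}]) · E[U^{κ−ε}] = E[(AU+B)^{κ−ε} − (AU)^{κ−ε}], and all the quantities appearing are finite. -/

import Mathlib

open MeasureTheory ProbabilityTheory Filter Topology

open scoped ENNReal

/-- A quasi-subadditivity of the power function: the constant in front of `x ^ p` can be taken
arbitrarily close to `1`. -/
theorem exists_rpow_add_le {p δ : ℝ} (hp : 0 < p) (hδ : 0 < δ) :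
    ∃ C : ℝ, 0 ≤ C ∧ ∀ x y : ℝ, 0 ≤ x → 0 ≤ y →
      (x + y) ^ p ≤ (1 + δ) * x ^ p + C * y ^ p := by
  obtain ⟨η, hη, hηp⟩ : ∃ η : ℝ, 0 < η ∧ (1 + η) ^ p = 1 + δ := by
    refine ⟨(1 + δ) ^ (1 / p) - 1, ?_, ?_⟩
    · have := Real.one_lt_rpow (x := 1 + δ) (z := 1 / p) (by linarith) (by positivity)
      linarith
    · rw [add_sub_cancel, ← Real.rpow_mul (by linarith), one_div_mul_cancel hp.ne', Real.rpow_one]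
  refine ⟨(1 + η⁻¹) ^ p, by positivity, fun x y hx hy => ?_⟩
  have hxp : 0 ≤ (1 + δ) * x ^ p := by positivity
  have hyp : 0 ≤ (1 + η⁻¹) ^ p * y ^ p := by positivity
  rcases le_total y (η * x) with h | h
  · calc (x + y) ^ p ≤ ((1 + η) * x) ^ p :=
          Real.rpow_le_rpow (by positivity) (by linarith) hp.le
      _ = (1 + δ) * x ^ p := by rw [Real.mul_rpow (by positivity) hx, hηp]
      _ ≤ _ := by linarith
  · have hxy : x ≤ η⁻¹ * y := by rwa [le_inv_mul_iff₀ hη]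
    calc (x + y) ^ p ≤ ((1 + η⁻¹) * y) ^ p :=
          Real.rpow_le_rpow (by positivity) (by linarith) hp.le
      _ = (1 + η⁻¹) ^ p * y ^ p := Real.mul_rpow (by positivity) hy
      _ ≤ _ := by linarith

/-- Jensen's inequality for truncated affine functions with random coefficients. -/
theorem lintegral_min_affine_le {Ω : Type*} [MeasurableSpace Ω] {μ : Measure Ω}
    [IsProbabilityMeasure μ] {V X Y : Ω → ℝ≥0∞} (hV : Measurable V) (hX : Measurable X)
    (hY : Measurable Y) (hindep : IndepFun V (fun ω => (X ω, Y ω)) μ) (M c d : ℝ≥0∞) :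
    ∫⁻ ω, min M (c * (X ω * V ω + Y ω) + d) ∂μ ≤
      ∫⁻ ω, min M (c * (∫⁻ ω', X ω' ∂μ) * V ω + (d + c * ∫⁻ ω', Y ω' ∂μ)) ∂μ := by
  have hXY : Measurable fun ω => (X ω, Y ω) := hX.prodMk hY
  have hmap := (indepFun_iff_map_prod_eq_prod_map_map hV.aemeasurable hXY.aemeasurable).1 hindep
  have : IsProbabilityMeasure (μ.map fun ω => (X ω, Y ω)) :=
    Measure.isProbabilityMeasure_map hXY.aemeasurable
  have hF : Measurable fun q : ℝ≥0∞ × ℝ≥0∞ × ℝ≥0∞ => min M (c * (q.2.1 * q.1 + q.2.2) + d) := by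
    fun_prop
  calc ∫⁻ ω, min M (c * (X ω * V ω + Y ω) + d) ∂μ
      = ∫⁻ q, min M (c * (q.2.1 * q.1 + q.2.2) + d) ∂(μ.map fun ω => (V ω, X ω, Y ω)) :=
        (lintegral_map hF (hV.prodMk hXY)).symm
    _ = ∫⁻ ω, ∫⁻ ω', min M (c * (X ω' * V ω + Y ω') + d) ∂μ ∂μ := by
        rw [hmap, lintegral_prod _ hF.aemeasurable, lintegral_map hF.lintegral_prod_right' hV]
        refine lintegral_congr fun ω => ?_
        exact lintegral_map (hF.comp measurable_prodMk_left) hXY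
    _ ≤ _ := by
        refine lintegral_mono fun ω => le_min ?_ ?_
        · calc ∫⁻ ω', min M (c * (X ω' * V ω + Y ω') + d) ∂μ
              ≤ ∫⁻ _, M ∂μ := lintegral_mono fun _ => min_le_left _ _
            _ = M := by simp
        · calc ∫⁻ ω', min M (c * (X ω' * V ω + Y ω') + d) ∂μ
              ≤ ∫⁻ ω', (c * (X ω' * V ω + Y ω') + d) ∂μ :=
                lintegral_mono fun _ => min_le_right _ _
            _ = c * (∫⁻ ω', X ω' ∂μ) * V ω + (d + c * ∫⁻ ω', Y ω' ∂μ) := by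
                rw [lintegral_add_right _ measurable_const,
                  lintegral_const_mul _ (by fun_prop),
                  lintegral_add_right _ hY, lintegral_mul_const _ hX]
                simp only [lintegral_const, measure_univ, mul_one]
                ring

/-- If `V` is stochastically dominated by `X * V + Y` with `(X, Y)` independent of `V`, then
`E V ≤ E Y / (1 - E X)` as soon as `E X < 1`. -/
theorem lintegral_le_of_stochastic_recursion {Ω : Type*} [MeasurableSpace Ω] {μ : Measure Ω}
    [IsProbabilityMeasure μ] {V X Y : Ω → ℝ≥0∞} (hV : Measurable V) (hX : Measurable X)
    (hY : Measurable Y) (hindep : IndepFun V (fun ω => (X ω, Y ω)) μ) (hVtop : ∀ ω, V ω ≠ ∞)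
    (hX1 : ∫⁻ ω, X ω ∂μ < 1)
    (hle : ∀ M c d : ℝ≥0∞,
      ∫⁻ ω, min M (c * V ω + d) ∂μ ≤ ∫⁻ ω, min M (c * (X ω * V ω + Y ω) + d) ∂μ) :
    ∫⁻ ω, V ω ∂μ ≤ (1 - ∫⁻ ω, X ω ∂μ)⁻¹ * ∫⁻ ω, Y ω ∂μ := by
  set a := ∫⁻ ω, X ω ∂μ
  set b := ∫⁻ ω, Y ω ∂μ
  have hiter (M : ℝ≥0∞) (n : ℕ) : ∫⁻ ω, min M (V ω) ∂μ ≤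
      ∫⁻ ω, min M (a ^ n * V ω + (∑ i ∈ Finset.range n, a ^ i) * b) ∂μ := by
    induction n with
    | zero => simp
    | succ n ih =>
      refine (ih.trans (hle _ _ _)).trans
        ((lintegral_min_affine_le hV hX hY hindep _ _ _).trans_eq ?_)
      rw [Finset.sum_range_succ, add_mul, pow_succ]
  have hbound (M : ℝ≥0∞) (hM : M ≠ ∞) : ∫⁻ ω, min M (V ω) ∂μ ≤ (1 - a)⁻¹ * b := by
    have hlim : Tendsto (fun n : ℕ => ∫⁻ ω, min M (a ^ n * V ω + (1 - a)⁻¹ * b) ∂μ) atTop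
        (𝓝 (∫⁻ _, min M (0 + (1 - a)⁻¹ * b) ∂μ)) := by
      refine tendsto_lintegral_of_dominated_convergence (fun _ => M) (fun n => by fun_prop)
        (fun n => ae_of_all _ fun ω => min_le_left _ _) (by simpa using hM)
        (ae_of_all _ fun ω => ?_)
      refine tendsto_const_nhds.min (Tendsto.add ?_ tendsto_const_nhds)
      simpa using ENNReal.Tendsto.mul_const
        (ENNReal.tendsto_pow_atTop_nhds_zero_of_lt_one hX1) (Or.inr (hVtop ω))
    refine (ge_of_tendsto' hlim fun n => (hiter M n).trans ?_).trans ?_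
    · refine lintegral_mono fun ω => min_le_min_left _ ?_
      gcongr
      rw [← ENNReal.tsum_geometric]
      exact ENNReal.sum_le_tsum _
    · simp
  have hmono : Tendsto (fun n : ℕ => ∫⁻ ω, min (n : ℝ≥0∞) (V ω) ∂μ) atTop
      (𝓝 (∫⁻ ω, V ω ∂μ)) := by
    refine lintegral_tendsto_of_tendsto_of_monotone (fun n => by fun_prop)
      (ae_of_all _ fun ω m n hmn => min_le_min_right _ (by exact_mod_cast hmn))
      (ae_of_all _ fun ω => ?_)
    simpa using ENNReal.tendsto_nat_nhds_top.min (tendsto_const_nhds (x := V ω))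
  exact le_of_tendsto' hmono fun n => hbound n (ENNReal.natCast_ne_top n)

/-- Integrability of a power passes to smaller positive powers. -/
theorem integrable_rpow_of_le {Ω : Type*} [MeasurableSpace Ω] {μ : Measure Ω}
    [IsFiniteMeasure μ] {X : Ω → ℝ} (hX : Measurable X) (hX0 : ∀ ω, 0 ≤ X ω) {p q : ℝ}
    (hp : 0 ≤ p) (hpq : p ≤ q) (hint : Integrable (fun ω => X ω ^ q) μ) :
    Integrable (fun ω => X ω ^ p) μ := by
  refine ((integrable_const (1 : ℝ)).add hint).mono' (by fun_prop) (ae_of_all _ fun ω => ?_)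
  have h0 := hX0 ω
  rw [Real.norm_of_nonneg (by positivity), Pi.add_apply]
  rcases le_total (X ω) 1 with h | h
  · have := Real.rpow_le_one h0 h hp
    have : 0 ≤ X ω ^ q := by positivity
    linarith
  · have := Real.rpow_le_rpow_of_exponent_le h hpq
    linarith

/-- Strict Jensen inequality: if `E X ^ q = 1` and `X` is not almost surely `1`, then
`E X ^ p < 1` for `0 < p < q`. -/
theorem integral_rpow_lt_one {Ω : Type*} [MeasurableSpace Ω] {μ : Measure Ω}
    [IsProbabilityMeasure μ] {X : Ω → ℝ} (hX : Measurable X) (hX0 : ∀ ω, 0 ≤ X ω) {p q : ℝ}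
    (hp : 0 < p) (hpq : p < q) (hint : Integrable (fun ω => X ω ^ q) μ)
    (hone : ∫ ω, X ω ^ q ∂μ = 1) (hne : μ {ω | X ω = 1} < 1) :
    ∫ ω, X ω ^ p ∂μ < 1 := by
  have hq : 0 < q := hp.trans hpq
  have hintp := integrable_rpow_of_le hX hX0 hp.le hpq.le hint
  have hpow (ω : Ω) : X ω ^ p = (1 + (X ω ^ q - 1)) ^ (p / q) := by
    rw [add_sub_cancel, ← Real.rpow_mul (hX0 ω), mul_div_cancel₀ _ hq.ne']
  have hnonneg (ω : Ω) : 0 ≤ X ω ^ q := Real.rpow_nonneg (hX0 ω) q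
  let g : Ω → ℝ := fun ω => 1 + p / q * (X ω ^ q - 1) - X ω ^ p
  have hg0 (ω : Ω) : 0 ≤ g ω := by
    have := rpow_one_add_le_one_add_mul_self (s := X ω ^ q - 1) (by linarith [hnonneg ω])
      (p := p / q) (by positivity) ((div_le_one hq).2 hpq.le)
    simp only [g, sub_nonneg, hpow ω]
    exact this
  have hi1 : Integrable (fun ω => p / q * (X ω ^ q - 1)) μ :=
    (hint.sub (integrable_const 1)).const_mul _
  have hi2 : Integrable (fun ω => 1 + p / q * (X ω ^ q - 1)) μ := (integrable_const 1).add hi1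
  have hgint : Integrable g μ := hi2.sub hintp
  have hg : ∫ ω, g ω ∂μ = 1 - ∫ ω, X ω ^ p ∂μ := by
    simp only [g]
    rw [integral_sub hi2 hintp, integral_add (integrable_const 1) hi1, integral_const_mul,
      integral_sub hint (integrable_const 1), hone]
    simp
  have hpos : 0 < ∫ ω, g ω ∂μ := by
    refine (integral_nonneg hg0).lt_of_ne fun h => hne.ne ?_
    have hae := (integral_eq_zero_iff_of_nonneg hg0 hgint).1 h.symm
    refine (mem_ae_iff_prob_eq_one (hX (measurableSet_singleton 1))).1 ?_
    filter_upwards [hae] with ω hω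
    by_contra hX1
    have hXq : X ω ^ q - 1 ≠ 0 := by
      intro h0
      exact hX1 ((Real.rpow_left_inj (hX0 ω) zero_le_one hq.ne').1
        (by rw [Real.one_rpow]; linarith))
    have := rpow_one_add_lt_one_add_mul_self (s := X ω ^ q - 1) (by linarith [hnonneg ω])
      hXq (p := p / q) (by positivity) ((div_lt_one hq).2 hpq)
    rw [← hpow ω] at this
    simp only [g, Pi.zero_apply] at hω
    linarith
  linarith

/-- A nonnegative solution of `U =_d A U + B` has a finite `p`-th moment as soon as
`E A ^ p < 1` and `E B ^ p < ∞`. -/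
theorem integrable_rpow_of_perpetuity {Ω : Type*} [MeasurableSpace Ω] {μ : Measure Ω}
    [IsProbabilityMeasure μ] {A B U : Ω → ℝ} {p : ℝ} (hp : 0 < p)
    (hA : Measurable A) (hB : Measurable B) (hU : Measurable U)
    (hA0 : ∀ ω, 0 ≤ A ω) (hB0 : ∀ ω, 0 ≤ B ω) (hU0 : ∀ᵐ ω ∂μ, 0 ≤ U ω)
    (hAp : Integrable (fun ω => A ω ^ p) μ) (hAp1 : ∫ ω, A ω ^ p ∂μ < 1)
    (hBp : Integrable (fun ω => B ω ^ p) μ)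
    (hindep : IndepFun U (fun ω => (A ω, B ω)) μ)
    (hfix : Measure.map U μ = Measure.map (fun ω => A ω * U ω + B ω) μ) :
    Integrable (fun ω => U ω ^ p) μ := by
  have ha0 : 0 ≤ ∫ ω, A ω ^ p ∂μ := integral_nonneg fun ω => Real.rpow_nonneg (hA0 ω) p
  obtain ⟨δ, hδ, hδ1⟩ : ∃ δ : ℝ, 0 < δ ∧ (1 + δ) * ∫ ω, A ω ^ p ∂μ < 1 := by
    refine ⟨1 - ∫ ω, A ω ^ p ∂μ, by linarith, ?_⟩
    nlinarith [pow_pos (sub_pos.2 hAp1) 2]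
  obtain ⟨C, hC, hCle⟩ := exists_rpow_add_le hp hδ
  let V : Ω → ℝ≥0∞ := fun ω => ENNReal.ofReal (U ω ^ p)
  let X : Ω → ℝ≥0∞ := fun ω => ENNReal.ofReal ((1 + δ) * A ω ^ p)
  let Y : Ω → ℝ≥0∞ := fun ω => ENNReal.ofReal (C * B ω ^ p)
  have hV : Measurable V := by fun_prop
  have hX : Measurable X := by fun_prop
  have hY : Measurable Y := by fun_prop
  have hind : IndepFun V (fun ω => (X ω, Y ω)) μ :=
    hindep.comp (φ := fun u : ℝ => ENNReal.ofReal (u ^ p))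
      (ψ := fun q : ℝ × ℝ =>
        (ENNReal.ofReal ((1 + δ) * q.1 ^ p), ENNReal.ofReal (C * q.2 ^ p)))
      (by fun_prop) (by fun_prop)
  have hXint : ∫⁻ ω, X ω ∂μ = ENNReal.ofReal ((1 + δ) * ∫ ω, A ω ^ p ∂μ) := by
    rw [← integral_const_mul, ofReal_integral_eq_lintegral_ofReal (hAp.const_mul _)
      (ae_of_all _ fun ω => mul_nonneg (by linarith) (Real.rpow_nonneg (hA0 ω) p))]
  have hX1 : ∫⁻ ω, X ω ∂μ < 1 := by
    rwa [hXint, ENNReal.ofReal_lt_one]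
  have hYtop : ∫⁻ ω, Y ω ∂μ ≠ ∞ := (hBp.const_mul C).lintegral_lt_top.ne
  have hle (M c d : ℝ≥0∞) : ∫⁻ ω, min M (c * V ω + d) ∂μ ≤
      ∫⁻ ω, min M (c * (X ω * V ω + Y ω) + d) ∂μ := by
    have hF : Measurable fun u : ℝ => min M (c * ENNReal.ofReal (u ^ p) + d) := by fun_prop
    have heq : ∫⁻ ω, min M (c * V ω + d) ∂μ =
        ∫⁻ ω, min M (c * ENNReal.ofReal ((A ω * U ω + B ω) ^ p) + d) ∂μ := by
      rw [← lintegral_map hF hU, hfix, lintegral_map hF (by fun_prop)]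
    rw [heq]
    refine lintegral_mono_ae ?_
    filter_upwards [hU0] with ω hω
    have hAω := hA0 ω
    have hBω := hB0 ω
    gcongr
    simp only [X, V, Y]
    rw [← ENNReal.ofReal_mul (by positivity), ← ENNReal.ofReal_add (by positivity) (by positivity)]
    refine ENNReal.ofReal_le_ofReal ((hCle _ _ (mul_nonneg hAω hω) hBω).trans_eq ?_)
    rw [Real.mul_rpow hAω hω, mul_assoc]
  have hfin : ∫⁻ ω, V ω ∂μ < ∞ :=
    (lintegral_le_of_stochastic_recursion hV hX hY hind (fun ω => ENNReal.ofReal_ne_top) hX1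
      hle).trans_lt (ENNReal.mul_lt_top
        (ENNReal.inv_lt_top.2 (tsub_pos_of_lt hX1)) hYtop.lt_top)
  refine (lintegral_ofReal_ne_top_iff_integrable
    (hU.pow_const p).aestronglyMeasurable ?_).1 hfin.ne
  filter_upwards [hU0] with ω hω using Real.rpow_nonneg hω p

/-- The identity `(1 − E[A^{κ−ε}]) E[U^{κ−ε}] = E[(AU+B)^{κ−ε} − (AU)^{κ−ε}]`
for every `ε ∈ (0, κ)`, all quantities being finite. -/
theorem moment_identity_below_kappa
    {Ω : Type*} [MeasurableSpace Ω] (μ : Measure Ω) [IsProbabilityMeasure μ]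
    (A B U : Ω → ℝ) (κ : ℝ)
    (hA : Measurable A) (hB : Measurable B) (hU : Measurable U)
    (hA0 : ∀ ω, 0 ≤ A ω) (hB0 : ∀ ω, 0 ≤ B ω) (hU0 : ∀ᵐ ω ∂μ, 0 ≤ U ω)
    (hκ : 0 < κ)
    (hAne1 : μ {ω | A ω = 1} < 1)
    (hBne0 : μ {ω | B ω = 0} < 1)
    (hAκint : Integrable (fun ω => A ω ^ κ) μ)
    (hAκ : ∫ ω, A ω ^ κ ∂μ = 1)
    (hBκ : Integrable (fun ω => B ω ^ κ) μ)
    (hindep : IndepFun U (fun ω => (A ω, B ω)) μ)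
    (hfix : Measure.map U μ = Measure.map (fun ω => A ω * U ω + B ω) μ) :
    ∀ ε : ℝ, ε ∈ Set.Ioo 0 κ →
      Integrable (fun ω => A ω ^ (κ - ε)) μ ∧
      Integrable (fun ω => U ω ^ (κ - ε)) μ ∧
      Integrable (fun ω => (A ω * U ω + B ω) ^ (κ - ε)) μ ∧
      Integrable (fun ω => (A ω * U ω) ^ (κ - ε)) μ ∧
      (1 - ∫ ω, A ω ^ (κ - ε) ∂μ) * ∫ ω, U ω ^ (κ - ε) ∂μ
        = ∫ ω, ((A ω * U ω + B ω) ^ (κ - ε) - (A ω * U ω) ^ (κ - ε)) ∂μ := by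
  intro ε ⟨hε, hεκ⟩
  set p := κ - ε
  have hp : 0 < p := by linarith
  have hpκ : p < κ := by linarith
  have hAp := integrable_rpow_of_le hA hA0 hp.le hpκ.le hAκint
  have hBp := integrable_rpow_of_le hB hB0 hp.le hpκ.le hBκ
  have hAp1 := integral_rpow_lt_one hA hA0 hp hpκ hAκint hAκ hAne1
  have hUp := integrable_rpow_of_perpetuity hp hA hB hU hA0 hB0 hU0 hAp hAp1 hBp hindep hfix
  have hident : IdentDistrib U (fun ω => A ω * U ω + B ω) μ μ :=
    ⟨hU.aemeasurable, by fun_prop, hfix⟩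
  have hidentp : IdentDistrib (fun ω => U ω ^ p) (fun ω => (A ω * U ω + B ω) ^ p) μ μ :=
    hident.comp (u := fun x : ℝ => x ^ p) (by fun_prop)
  have hAUB : Integrable (fun ω => (A ω * U ω + B ω) ^ p) μ := hidentp.integrable_iff.1 hUp
  have hindp : IndepFun (fun ω => A ω ^ p) (fun ω => U ω ^ p) μ :=
    hindep.symm.comp (φ := fun q : ℝ × ℝ => q.1 ^ p) (ψ := fun x : ℝ => x ^ p)
      (by fun_prop) (by fun_prop)
  have hmul : (fun ω => A ω ^ p * U ω ^ p) =ᵐ[μ] fun ω => (A ω * U ω) ^ p := by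
    filter_upwards [hU0] with ω hω using (Real.mul_rpow (hA0 ω) hω).symm
  have hAU : Integrable (fun ω => (A ω * U ω) ^ p) μ :=
    (hindp.integrable_mul hAp hUp).congr hmul
  refine ⟨hAp, hUp, hAUB, hAU, ?_⟩
  rw [integral_sub hAUB hAU, ← hidentp.integral_eq, ← integral_congr_ae hmul,
    hindp.integral_fun_mul_eq_mul_integral hAp.aestronglyMeasurable hUp.aestronglyMeasurable]
  ring
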